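/- Inverse update is the pointwise least inverse (property of Definition 7): For every energy e' ∈ ℕ^N and energy update u, the inverse update upd⁻¹(e',u) defined below satisfies: (a) upd(upd⁻¹(e',u), u) is defined and e' ≤ upd(upd⁻¹(e',u), u); and (b) for every e ∈ ℕ^N such that upd(e,u) is defined and e' ≤ upd(e,u), it holds that upd⁻¹(e',u) ≤ e. Hence upd⁻¹(e',u) = inf { e ∈ ℕ^N | upd(e,u) is defined and e' ≤ upd(e,u) }. -/

import Mathlib

/-! ### Energies and energy updates -/

/-- (Finite) energies: vectors in `ℕ^N`. -/
abbrev Energy (N : ℕ) := Fin N → ℕ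

/-- Extended energies: vectors in `(ℕ ∪ {∞})^N`. -/
abbrev EnergyE (N : ℕ) := Fin N → ℕ∞

/-- Embedding of energies into extended energies. -/
def Energy.toE {N : ℕ} (e : Energy N) : EnergyE N := fun k => (e k : ℕ∞)

/-- A component of an energy update: `-1`, `0`, or `min_D`. -/
inductive UpdComp (N : ℕ) : Type where
  | dec : UpdComp N
  | zero : UpdComp N
  | minOf (D : Finset (Fin N)) : UpdComp N
deriving DecidableEq

/-- An energy update: a vector of update components, where a `min_D`
component at index `k` must satisfy `k ∈ D`. -/
structure EnergyUpdate (N : ℕ) : Type where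
  comp : Fin N → UpdComp N
  valid : ∀ k D, comp k = UpdComp.minOf D → k ∈ D

open Classical in
/-- Applying an energy update to an extended energy: component `k` becomes
`e k - 1`, `e k`, or `min_{d ∈ D} e d`; the result is undefined (`none`) if
some component would become negative. -/
noncomputable def applyUpdE {N : ℕ} (e : EnergyE N) (u : EnergyUpdate N) :
    Option (EnergyE N) :=
  if ∀ k, u.comp k = UpdComp.dec → e k ≠ 0 then
    some (fun k =>
      match u.comp k with
      | UpdComp.dec => e k - 1
      | UpdComp.zero => e k
      | UpdComp.minOf D => (insert k D).inf' (Finset.insert_nonempty k D) e)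
  else none

open Classical in
/-- Applying an energy update to a (finite) energy. -/
noncomputable def applyUpdN {N : ℕ} (e : Energy N) (u : EnergyUpdate N) :
    Option (Energy N) :=
  if ∀ k, u.comp k = UpdComp.dec → e k ≠ 0 then
    some (fun k =>
      match u.comp k with
      | UpdComp.dec => e k - 1
      | UpdComp.zero => e k
      | UpdComp.minOf D => (insert k D).inf' (Finset.insert_nonempty k D) e)
  else none

/-! ### Declining energy games -/

/-- A declining `N`-dimensional energy game: positions (partitioned into defender
positions and attacker positions), moves, and a weight function assigning an
energy update to each move. -/
structure EnergyGame (N : ℕ) where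
  Pos : Type
  defender : Pos → Prop
  move : Pos → Pos → Prop
  weight : Pos → Pos → EnergyUpdate N

/-- The attacker wins from position `g` with (extended) initial energy budget `e`:
inductive (attractor) characterization of the existence of an attacker winning
strategy.  (The attacker wins exactly the finite plays that get stuck at a defender
position without the energy having become negative, so the attacker has a winning
strategy iff they can force the play into a stuck defender position in finitely
many steps while keeping all energy levels defined.) -/
inductive AttackerWins {N : ℕ} (G : EnergyGame N) : G.Pos → EnergyE N → Prop where
  | attack {g g' : G.Pos} {e e' : EnergyE N} :
      ¬ G.defender g → G.move g g' →
      applyUpdE e (G.weight g g') = some e' →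
      AttackerWins G g' e' → AttackerWins G g e
  | defend {g : G.Pos} {e : EnergyE N} :
      G.defender g →
      (∀ g', G.move g g' → (applyUpdE e (G.weight g g')).isSome) →
      (∀ g' e', G.move g g' → applyUpdE e (G.weight g g') = some e' →
        AttackerWins G g' e') →
      AttackerWins G g e

open Classical in
/-- The inverse update `upd⁻¹(e',u)` (Definition 7): the supremum of the vector `e`
with `e_i = e'_i − u_i` for numeric components (`e_i = e'_i` otherwise) and, for
each `i` with `u_i = min_D`, the vector `m(i)` with `(m(i))_j = e'_i` for `j ∈ D`
and `0` otherwise. -/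
noncomputable def updInv {N : ℕ} (e' : Energy N) (u : EnergyUpdate N) : Energy N :=
  fun j =>
    max
      (match u.comp j with
        | UpdComp.dec => e' j + 1
        | UpdComp.zero => e' j
        | UpdComp.minOf _ => e' j)
      ((Finset.univ.filter
          (fun i => ∃ D, u.comp i = UpdComp.minOf D ∧ j ∈ D)).sup e')

/-- The inverse update is a lower adjoint of the update: it lies below `e` exactly when the
update of `e` is defined and lies above `e'`. -/
theorem updInv_le_iff {N : ℕ} (e' e : Energy N) (u : EnergyUpdate N) :
    updInv e' u ≤ e ↔ ∃ r, applyUpdN e u = some r ∧ e' ≤ r := by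
  simp only [applyUpdN, Option.ite_none_right_eq_some, Option.some.injEq, and_assoc,
    exists_and_left, exists_eq_left']
  simp only [updInv, Pi.le_def, max_le_iff, Finset.sup_le_iff, Finset.mem_filter,
    Finset.mem_univ, true_and]
  constructor
  · intro h
    refine ⟨fun k hk => ?_, fun k => ?_⟩
    · have := (h k).1
      simp only [hk] at this
      lia
    · have hk := (h k).1
      cases hu : u.comp k with
      | dec => simp only [hu] at hk ⊢; lia
      | zero => simpa only [hu] using hk
      | minOf D =>
        refine Finset.le_inf' _ _ fun j hj => ?_
        rw [Finset.insert_eq_of_mem (u.valid k D hu)] at hj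
        exact (h j).2 k ⟨D, hu, hj⟩
  · rintro ⟨hpos, h⟩ j
    refine ⟨?_, ?_⟩
    · have hj := h j
      cases hu : u.comp j with
      | dec => have := hpos j hu; simp only [hu] at hj ⊢; lia
      | zero => simpa only [hu] using hj
      | minOf D =>
        simp only [hu] at hj
        exact hj.trans (Finset.inf'_le _ (Finset.mem_insert_self j D))
    · rintro i ⟨D, hu, hj⟩
      have hi := h i
      simp only [hu] at hi
      exact hi.trans (Finset.inf'_le _ (Finset.mem_insert_of_mem hj))

/-- **Inverse update is the pointwise least inverse** (property of Definition 7):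
(a) `upd(upd⁻¹(e',u),u)` is defined and `e' ≤ upd(upd⁻¹(e',u),u)`;
(b) whenever `upd(e,u)` is defined and `e' ≤ upd(e,u)`, we have `upd⁻¹(e',u) ≤ e`;
hence `upd⁻¹(e',u)` is the pointwise infimum of all such `e`. -/
theorem updInv_least_inverse {N : ℕ} (e' : Energy N) (u : EnergyUpdate N) :
    (∃ r, applyUpdN (updInv e' u) u = some r ∧ e' ≤ r) ∧
    (∀ e r, applyUpdN e u = some r → e' ≤ r → updInv e' u ≤ e) ∧
    (∀ j, updInv e' u j =
      sInf ((fun e : Energy N => e j) ''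
        {e | ∃ r, applyUpdN e u = some r ∧ e' ≤ r})) := by
  have hset : {e | ∃ r, applyUpdN e u = some r ∧ e' ≤ r} = Set.Ici (updInv e' u) :=
    Set.ext fun e => (updInv_le_iff e' e u).symm
  refine ⟨(updInv_le_iff e' _ u).1 le_rfl,
    fun e r hr hle => (updInv_le_iff e' e u).2 ⟨r, hr, hle⟩, fun j => ?_⟩
  rw [hset]
  exact ((Function.monotone_eval j).map_isLeast isLeast_Ici).csInf_eq.symm
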